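/- For a primitive N-th root of unity q in a field, and any nonnegative integers r, s, the q-binomial coefficient satisfies binom(rN, sN)_q = binom(r, s) (the ordinary binomial coefficient). -/

import Mathlib

/-- The Gaussian (q-)binomial coefficient, defined by the q-Pascal recursion
`binom(n+1,k+1)_q = binom(n,k)_q + q^(k+1) binom(n,k+1)_q`, so that it is
well-defined even when `q` is a root of unity. -/
def qBinom {K : Type*} [CommRing K] (q : K) : ℕ → ℕ → K
  | _, 0 => 1
  | 0, _ + 1 => 0
  | n + 1, k + 1 => qBinom q n k + q ^ (k + 1) * qBinom q n (k + 1)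

namespace qBinom

section CommRing

variable {K : Type*} [CommRing K] (q : K)

theorem zero_right (n : ℕ) : qBinom q n 0 = 1 := by
  cases n <;> rfl

theorem zero_succ (k : ℕ) : qBinom q 0 (k + 1) = 0 := rfl

theorem succ_succ (n k : ℕ) :
    qBinom q (n + 1) (k + 1) = qBinom q n k + q ^ (k + 1) * qBinom q n (k + 1) := rfl

theorem eq_zero_of_lt {n k : ℕ} (h : n < k) : qBinom q n k = 0 := by
  induction n generalizing k with
  | zero =>
    obtain ⟨k, rfl⟩ := Nat.exists_eq_succ_of_ne_zero h.ne'
    rfl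
  | succ n ih =>
    obtain ⟨k, rfl⟩ := Nat.exists_eq_succ_of_ne_zero (Nat.ne_zero_of_lt h)
    rw [Nat.succ_eq_add_one, succ_succ, ih (by lia), ih (by lia), mul_zero, add_zero]

theorem self (n : ℕ) : qBinom q n n = 1 := by
  induction n with
  | zero => rfl
  | succ n ih => rw [succ_succ, ih, eq_zero_of_lt q n.lt_succ_self, mul_zero, add_zero]

/-- The relation between consecutive q-binomial coefficients in the same row. -/
theorem pow_mul_succ_right (n k : ℕ) :
    q ^ k * (q ^ (k + 1) - 1) * qBinom q n (k + 1) = (q ^ n - q ^ k) * qBinom q n k := by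
  induction n generalizing k with
  | zero => cases k <;> simp [zero_succ, zero_right]
  | succ n ih =>
    cases k with
    | zero =>
      have h := ih 0
      simp only [zero_right, succ_succ] at h ⊢
      linear_combination q * h
    | succ k =>
      rw [succ_succ, succ_succ]
      linear_combination q ^ (k + 2) * ih (k + 1) + q * ih k

end CommRing

variable {K : Type*} [Field K] {q : K} {N : ℕ}

theorem orderOf_succ_eq_zero (hq : IsPrimitiveRoot q N) {k : ℕ} (hk : k + 1 < N) :
    qBinom q N (k + 1) = 0 := by
  have h := pow_mul_succ_right q N k
  have hr : (q ^ N - q ^ k) * qBinom q N k = 0 := by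
    cases k with
    | zero => simp [hq.pow_eq_one]
    | succ k => rw [orderOf_succ_eq_zero hq (by lia), mul_zero]
  rw [hr] at h
  have hq0 : q ≠ 0 := hq.ne_zero (by lia)
  have h1 : q ^ (k + 1) - 1 ≠ 0 := sub_ne_zero.2 (hq.pow_ne_one_of_pos_of_lt k.succ_ne_zero hk)
  exact (mul_eq_zero.1 h).resolve_left (mul_ne_zero (pow_ne_zero _ hq0) h1)

/-- Adding the order of `q` to the upper index does not change the coefficients with small lower
index. -/
theorem add_orderOf_left (hq : IsPrimitiveRoot q N) (n : ℕ) {k : ℕ} (hk : k < N) :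
    qBinom q (n + N) k = qBinom q n k := by
  induction n generalizing k with
  | zero =>
    cases k with
    | zero => simp only [zero_right]
    | succ k => rw [zero_add, orderOf_succ_eq_zero hq hk, zero_succ]
  | succ n ih =>
    cases k with
    | zero => simp only [zero_right]
    | succ k => rw [Nat.add_right_comm, succ_succ, succ_succ, ih hk, ih (by lia)]

/-- Pascal's rule with step the order of `q`. -/
theorem add_orderOf_add_orderOf (hN : 0 < N) (hq : IsPrimitiveRoot q N) (n k : ℕ) :
    qBinom q (n + N) (k + N) = qBinom q n k + qBinom q n (k + N) := by
  induction n generalizing k with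
  | zero =>
    rw [zero_add, eq_zero_of_lt q (show 0 < k + N by lia), add_zero]
    cases k with
    | zero => rw [zero_add, self, zero_right]
    | succ k => rw [eq_zero_of_lt q (show N < k + 1 + N by lia), zero_succ]
  | succ n ih =>
    rw [Nat.add_right_comm n 1 N]
    cases k with
    | zero =>
      obtain ⟨m, rfl⟩ := Nat.exists_eq_succ_of_ne_zero hN.ne'
      have h := ih 0
      have hm := add_orderOf_left hq n m.lt_succ_self
      simp only [zero_add, Nat.succ_eq_add_one, zero_right] at h hm ⊢
      rw [succ_succ, succ_succ, h, hm]
      have hqN : q ^ (m + 1) = 1 := hq.pow_eq_one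
      linear_combination hqN
    | succ k =>
      have h := ih (k + 1)
      rw [Nat.add_right_comm k 1 N] at h ⊢
      rw [succ_succ, succ_succ, succ_succ, h, ih k]
      linear_combination q ^ (k + 1) * qBinom q n (k + 1) * hq.pow_eq_one

end qBinom

/-- For a primitive `N`-th root of unity `q` in a field, the q-binomial
coefficient satisfies `binom(rN, sN)_q = binom(r, s)`. -/
theorem qBinom_mul_orderOf {K : Type*} [Field K] (q : K) (N : ℕ) (hN : 1 < N)
    (hq : IsPrimitiveRoot q N) (r s : ℕ) :
    qBinom q (r * N) (s * N) = (Nat.choose r s : K) := by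
  induction r generalizing s with
  | zero =>
    cases s with
    | zero => simp [qBinom.zero_right]
    | succ s =>
      rw [qBinom.eq_zero_of_lt q (by simp; lia), Nat.choose_zero_succ, Nat.cast_zero]
  | succ r ih =>
    cases s with
    | zero => simp [qBinom.zero_right]
    | succ s =>
      have h := ih (s + 1)
      rw [Nat.succ_mul] at h
      rw [Nat.succ_mul, Nat.succ_mul, qBinom.add_orderOf_add_orderOf (by lia) hq, ih, h,
        Nat.choose_succ_succ, Nat.cast_add]
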